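/- Let U ⊆ ℂ be open and let a₁₃, a₁₄, a₃₄, φ, b₁₃, b₁₄ : U → ℂ be holomorphic functions satisfying φ′ = a₃₄, b₁₃′ = a₁₃·cos φ + a₁₄·sin φ, and b₁₄′ = -a₁₃·sin φ + a₁₄·cos φ on U. Define the 4×4 matrix-valued functions A₁ = [[0,0,a₁₃,a₁₄],[0,0,-a₁₃,-a₁₄],[a₁₃,a₁₃,0,a₃₄],[a₁₄,a₁₄,-a₃₄,0]] and F = Ĥ·T, where q = (b₁₃² + b₁₄²)/2, Ĥ = [[1+q, q, b₁₃, b₁₄],[-q, 1-q, -b₁₃, -b₁₄],[b₁₃, b₁₃, 1, 0],[b₁₄, b₁₄, 0, 1]], and T = [[1,0,0,0],[0,1,0,0],[0,0,cos φ, sin φ],[0,0,-sin φ, cos φ]]. Then F′(z) = F(z)·A₁(z) for every z ∈ U. In particular, if z₀ ∈ U and φ(z₀) = b₁₃(z₀) = b₁₄(z₀) = 0, then F solves the matrix ODE F⁻¹dF = A₁ dz with initial condition F(z₀) = I₄. -/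

import Mathlib

open Matrix

/-- The coefficient matrix `A₁` of the ODE. -/
noncomputable def odeCoeff (a₁₃ a₁₄ a₃₄ : ℂ → ℂ) (z : ℂ) : Matrix (Fin 4) (Fin 4) ℂ :=
  !![0, 0, a₁₃ z, a₁₄ z;
     0, 0, -a₁₃ z, -a₁₄ z;
     a₁₃ z, a₁₃ z, 0, a₃₄ z;
     a₁₄ z, a₁₄ z, -a₃₄ z, 0]

/-- The explicit solution `F = Ĥ·T`. -/
noncomputable def odeSol (φ b₁₃ b₁₄ : ℂ → ℂ) (z : ℂ) : Matrix (Fin 4) (Fin 4) ℂ :=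
  (!![1 + (b₁₃ z ^ 2 + b₁₄ z ^ 2) / 2, (b₁₃ z ^ 2 + b₁₄ z ^ 2) / 2, b₁₃ z, b₁₄ z;
      -((b₁₃ z ^ 2 + b₁₄ z ^ 2) / 2), 1 - (b₁₃ z ^ 2 + b₁₄ z ^ 2) / 2, -b₁₃ z, -b₁₄ z;
      b₁₃ z, b₁₃ z, 1, 0;
      b₁₄ z, b₁₄ z, 0, 1]) *
  (!![1, 0, 0, 0;
      0, 1, 0, 0;
      0, 0, Complex.cos (φ z), Complex.sin (φ z);
      0, 0, -Complex.sin (φ z), Complex.cos (φ z)])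

/-- If `φ′ = a₃₄`, `b₁₃′ = a₁₃ cos φ + a₁₄ sin φ` and
`b₁₄′ = -a₁₃ sin φ + a₁₄ cos φ` on an open set `U`, with `a₁₃, a₁₄, a₃₄`
holomorphic on `U`, then `F = Ĥ·T` satisfies `F′(z) = F(z)·A₁(z)` (entrywise)
for every `z ∈ U`; and if moreover `φ(z₀) = b₁₃(z₀) = b₁₄(z₀) = 0` at some
`z₀ ∈ U`, then `F(z₀) = I₄`. -/
theorem ode_explicit_solution (U : Set ℂ) (hU : IsOpen U)
    (a₁₃ a₁₄ a₃₄ φ b₁₃ b₁₄ : ℂ → ℂ)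
    (ha₁₃ : DifferentiableOn ℂ a₁₃ U) (ha₁₄ : DifferentiableOn ℂ a₁₄ U)
    (ha₃₄ : DifferentiableOn ℂ a₃₄ U)
    (hφ : ∀ z ∈ U, HasDerivAt φ (a₃₄ z) z)
    (hb₁₃ : ∀ z ∈ U,
      HasDerivAt b₁₃ (a₁₃ z * Complex.cos (φ z) + a₁₄ z * Complex.sin (φ z)) z)
    (hb₁₄ : ∀ z ∈ U,
      HasDerivAt b₁₄ (-(a₁₃ z) * Complex.sin (φ z) + a₁₄ z * Complex.cos (φ z)) z) :
    (∀ z ∈ U, ∀ i j : Fin 4,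
        HasDerivAt (fun w => odeSol φ b₁₃ b₁₄ w i j)
          ((odeSol φ b₁₃ b₁₄ z * odeCoeff a₁₃ a₁₄ a₃₄ z) i j) z) ∧
    (∀ z₀ ∈ U, φ z₀ = 0 → b₁₃ z₀ = 0 → b₁₄ z₀ = 0 → odeSol φ b₁₃ b₁₄ z₀ = 1) := by
  have hF : ∀ w, odeSol φ b₁₃ b₁₄ w =
      !![1 + (b₁₃ w ^ 2 + b₁₄ w ^ 2) / 2, (b₁₃ w ^ 2 + b₁₄ w ^ 2) / 2,
          b₁₃ w * Complex.cos (φ w) - b₁₄ w * Complex.sin (φ w),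
          b₁₃ w * Complex.sin (φ w) + b₁₄ w * Complex.cos (φ w);
        -((b₁₃ w ^ 2 + b₁₄ w ^ 2) / 2), 1 - (b₁₃ w ^ 2 + b₁₄ w ^ 2) / 2,
          -(b₁₃ w * Complex.cos (φ w) - b₁₄ w * Complex.sin (φ w)),
          -(b₁₃ w * Complex.sin (φ w) + b₁₄ w * Complex.cos (φ w));
        b₁₃ w, b₁₃ w, Complex.cos (φ w), Complex.sin (φ w);
        b₁₄ w, b₁₄ w, -Complex.sin (φ w), Complex.cos (φ w)] := by
    intro w
    unfold odeSol
    ext i j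
    fin_cases i <;> fin_cases j <;>
      simp [Matrix.mul_apply, Fin.sum_univ_four] <;> ring
  refine ⟨?_, ?_⟩
  · intro z hz i j
    have h3 := hb₁₃ z hz
    have h4 := hb₁₄ z hz
    have hc := (hφ z hz).ccos
    have hs := (hφ z hz).csin
    have hq := ((h3.fun_pow 2).fun_add (h4.fun_pow 2)).div_const 2
    have hf := (h3.fun_mul hc).fun_sub (h4.fun_mul hs)
    have hg := (h3.fun_mul hs).fun_add (h4.fun_mul hc)
    have hcs := Complex.sin_sq_add_cos_sq (φ z)
    simp only [hF, odeCoeff]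
    fin_cases i <;> fin_cases j <;>
      simp [Matrix.mul_apply, Fin.sum_univ_four]
    · exact hq.congr_deriv (by push_cast; ring)
    · exact hq.congr_deriv (by push_cast; ring)
    · exact hf.congr_deriv (by linear_combination a₁₃ z * hcs)
    · exact hg.congr_deriv (by linear_combination a₁₄ z * hcs)
    · exact hq.fun_neg.congr_deriv (by push_cast; ring)
    · exact (hq.const_sub 1).congr_deriv (by push_cast; ring)
    · exact (hf.fun_neg.congr_deriv (by linear_combination -a₁₃ z * hcs)).congr_of_eventuallyEq
        (Filter.Eventually.of_forall fun w => by ring)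
    · exact (hg.fun_neg.congr_deriv (by linear_combination -a₁₄ z * hcs)).congr_of_eventuallyEq
        (Filter.Eventually.of_forall fun w => by ring)
    · exact h3.congr_deriv (by ring)
    · exact h3.congr_deriv (by ring)
    · exact hc.congr_deriv (by ring)
    · exact hs.congr_deriv (by ring)
    · exact h4.congr_deriv (by ring)
    · exact h4.congr_deriv (by ring)
    · exact hs.fun_neg.congr_deriv (by ring)
    · exact hc.congr_deriv (by ring)
  · intro z hz h1 h2 h3
    rw [hF, h1, h2, h3]
    ext i j
    fin_cases i <;> fin_cases j <;> simp
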